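/- Let k be an integer and suppose x_0 ∈ (2kπ, 2(k+1)π). Then the iterates of the MM map x_{n+1} = x_n + sin(x_n) remain in the open interval (2kπ, 2(k+1)π) for all n, and the sequence (x_n) converges to (2k+1)π, the unique minimizer of cos(x) on that interval. -/

import Mathlib

theorem abs_sub_sin (u : ℝ) : |u - Real.sin u| = |u| - Real.sin |u| := by
  have key : ∀ v : ℝ, 0 ≤ v → |v - Real.sin v| = |v| - Real.sin |v| := fun v hv => by
    rw [abs_of_nonneg hv, abs_of_nonneg (sub_nonneg.2 (Real.sin_le hv))]
  rcases le_total 0 u with h | h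
  · exact key u h
  · have := key (-u) (neg_nonneg.2 h)
    rwa [abs_neg, Real.sin_neg, ← neg_sub', abs_neg] at this

theorem sub_sin_iterates_mem_Ico {a : ℕ → ℝ} (h0 : a 0 ∈ Set.Ico 0 Real.pi)
    (ha : ∀ n, a (n + 1) = a n - Real.sin (a n)) (n : ℕ) : a n ∈ Set.Ico 0 Real.pi := by
  induction n with
  | zero => exact h0
  | succ n ih =>
    have h1 := Real.sin_le ih.1
    have h2 := Real.sin_nonneg_of_nonneg_of_le_pi ih.1 ih.2.le
    rw [ha]
    exact ⟨by linarith, by linarith [ih.2]⟩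

theorem tendsto_sub_sin_iterates {a : ℕ → ℝ} (h0 : a 0 ∈ Set.Ico 0 Real.pi)
    (ha : ∀ n, a (n + 1) = a n - Real.sin (a n)) :
    Filter.Tendsto a Filter.atTop (nhds 0) := by
  have hmem := sub_sin_iterates_mem_Ico h0 ha
  have hanti : Antitone a := antitone_nat_of_succ_le fun n => by
    have := Real.sin_nonneg_of_nonneg_of_le_pi (hmem n).1 (hmem n).2.le
    rw [ha]
    linarith
  have hbdd : BddBelow (Set.range a) := ⟨0, by rintro _ ⟨n, rfl⟩; exact (hmem n).1⟩
  obtain ⟨L, hL⟩ : ∃ L, Filter.Tendsto a Filter.atTop (nhds L) :=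
    ⟨_, tendsto_atTop_ciInf hanti hbdd⟩
  have hstep : Filter.Tendsto (fun n => a (n + 1)) Filter.atTop (nhds (L - Real.sin L)) := by
    simp only [ha]
    exact hL.sub ((Real.continuous_sin.tendsto L).comp hL)
  have hfix : L = L - Real.sin L :=
    tendsto_nhds_unique (hL.comp (Filter.tendsto_add_atTop_nat 1)) hstep
  have hL0 : 0 ≤ L := ge_of_tendsto' hL fun n => (hmem n).1
  have hLpi : L < Real.pi := (hanti.le_of_tendsto hL 0).trans_lt h0.2
  have : L = 0 :=
    (Real.sin_eq_zero_iff_of_lt_of_lt (by linarith [Real.pi_pos]) hLpi).1 (by linarith)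
  rwa [this] at hL

theorem sin_odd_mul_pi_add (k : ℤ) (v : ℝ) :
    Real.sin ((2 * (k : ℝ) + 1) * Real.pi + v) = -Real.sin v := by
  rw [show (2 * (k : ℝ) + 1) * Real.pi + v = v + Real.pi + k * (2 * Real.pi) by ring,
    Real.sin_add_int_mul_two_pi, Real.sin_add_pi]

theorem cos_odd_mul_pi_add (k : ℤ) (v : ℝ) :
    Real.cos ((2 * (k : ℝ) + 1) * Real.pi + v) = -Real.cos v := by
  rw [show (2 * (k : ℝ) + 1) * Real.pi + v = v + Real.pi + k * (2 * Real.pi) by ring,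
    Real.cos_add_int_mul_two_pi, Real.cos_add_pi]

theorem mem_Ioo_even_mul_pi_iff (k : ℤ) (y : ℝ) :
    y ∈ Set.Ioo (2 * (k : ℝ) * Real.pi) (2 * ((k : ℝ) + 1) * Real.pi) ↔
      |y - (2 * (k : ℝ) + 1) * Real.pi| < Real.pi := by
  rw [abs_lt, Set.mem_Ioo]
  constructor <;> rintro ⟨h1, h2⟩ <;> constructor <;> linarith

/-- If `x₀ ∈ (2kπ, 2(k+1)π)`, the MM iterates `x_{n+1} = x_n + sin(x_n)` remain in that open
interval and converge to `(2k+1)π`, the unique minimizer of `cos` on the interval. -/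
theorem mm_cosine_iterates_converge (k : ℤ) (x : ℕ → ℝ)
    (hx0 : x 0 ∈ Set.Ioo (2 * (k : ℝ) * Real.pi) (2 * ((k : ℝ) + 1) * Real.pi))
    (hiter : ∀ n, x (n + 1) = x n + Real.sin (x n)) :
    (∀ n, x n ∈ Set.Ioo (2 * (k : ℝ) * Real.pi) (2 * ((k : ℝ) + 1) * Real.pi)) ∧
    Filter.Tendsto x Filter.atTop (nhds ((2 * (k : ℝ) + 1) * Real.pi)) ∧
    (∀ y ∈ Set.Ioo (2 * (k : ℝ) * Real.pi) (2 * ((k : ℝ) + 1) * Real.pi),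
      Real.cos ((2 * (k : ℝ) + 1) * Real.pi) ≤ Real.cos y ∧
      (Real.cos y = Real.cos ((2 * (k : ℝ) + 1) * Real.pi) →
        y = (2 * (k : ℝ) + 1) * Real.pi)) := by
  set c := (2 * (k : ℝ) + 1) * Real.pi with hc
  have ha : ∀ n, |x (n + 1) - c| = |x n - c| - Real.sin |x n - c| := fun n => by
    have hs := sin_odd_mul_pi_add k (x n - c)
    rw [← hc, add_sub_cancel] at hs
    rw [← abs_sub_sin, hiter, hs]
    ring_nf
  have h0 : |x 0 - c| ∈ Set.Ico 0 Real.pi :=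
    ⟨abs_nonneg _, (mem_Ioo_even_mul_pi_iff k _).1 hx0⟩
  refine ⟨fun n => (mem_Ioo_even_mul_pi_iff k _).2
    (sub_sin_iterates_mem_Ico (a := fun n => |x n - c|) h0 ha n).2, ?_, fun y hy => ?_⟩
  · rw [tendsto_iff_dist_tendsto_zero]
    exact tendsto_sub_sin_iterates (a := fun n => |x n - c|) h0 ha
  · have hcos : Real.cos c = -1 := by
      simpa using cos_odd_mul_pi_add k 0
    refine ⟨hcos ▸ Real.neg_one_le_cos y, fun h => ?_⟩
    have hv := cos_odd_mul_pi_add k (y - c)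
    rw [← hc, add_sub_cancel, h, hcos, neg_inj] at hv
    have hy' := abs_lt.1 ((mem_Ioo_even_mul_pi_iff k y).1 hy)
    rw [← hc] at hy'
    exact sub_eq_zero.1 ((Real.cos_eq_one_iff_of_lt_of_lt (by linarith [Real.pi_pos])
      (by linarith [Real.pi_pos])).1 hv.symm)
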